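/- arXiv:2603.07172 — 3 statements merged into one kernel-verified Lean document; each statement's English description precedes it below -/
import Mathlib

section
/- Let k ≥ 3 and let m be an integer with 1 ≤ m ≤ k-2. Then L_{-(mk-1)}^{(k)} = -2^(m-1). -/
/-- `L : ℤ → ℤ` is the `k`-generalized Lucas sequence: it satisfies the order-`k`
recurrence everywhere, with `L 0 = 2`, `L 1 = 1`, and `L n = 0` for `-(k-2) ≤ n ≤ -1`. -/
def IsGenLucas (k : ℕ) (L : ℤ → ℤ) : Prop :=
  (∀ n : ℤ, L n = ∑ i ∈ Finset.Icc 1 k, L (n - (i : ℤ))) ∧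
  L 0 = 2 ∧ L 1 = 1 ∧ ∀ n : ℤ, -((k : ℤ) - 2) ≤ n → n ≤ -1 → L n = 0

namespace IsGenLucas

variable {k : ℕ} {L : ℤ → ℤ}

theorem eq_sum_range (hL : IsGenLucas k L) (n : ℤ) :
    L (n + 1) = ∑ i ∈ Finset.range k, L (n - i) := by
  rw [hL.1 (n + 1), Finset.range_eq_Ico,
    ← Finset.sum_Ico_add_right_sub_eq 0 k 1 (f := fun i : ℕ => L (n - i))]
  refine Finset.sum_congr (by ext i; simp) fun i hi => ?_
  have : 1 ≤ i := by simp at hi; omega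
  congr 1
  push_cast [this]
  ring

theorem sub_order (hL : IsGenLucas k L) (n : ℤ) : L (n - k) = 2 * L n - L (n + 1) := by
  have h₁ := Finset.sum_range_succ (fun i : ℕ => L (n - i)) k
  have h₂ := Finset.sum_range_succ' (fun i : ℕ => L (n - i)) k
  have h₃ : ∑ i ∈ Finset.range k, L (n - ((i + 1 : ℕ) : ℤ)) = L n := by
    have h := hL.eq_sum_range (n - 1)
    rw [sub_add_cancel] at h
    rw [h]
    refine Finset.sum_congr rfl fun i _ => ?_
    congr 1
    push_cast
    ring
  rw [← hL.eq_sum_range] at h₁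
  rw [h₃] at h₂
  simp only [Nat.cast_zero, sub_zero] at h₂
  linarith

theorem eq_zero (hL : IsGenLucas k L) (m : ℕ) :
    ∀ j : ℤ, (m : ℤ) < j → j ≤ (k : ℤ) - 2 → L (-((m : ℤ) * k + j)) = 0 := by
  induction m with
  | zero =>
    intro j hj hjk
    apply hL.2.2.2 <;> push_cast at * <;> linarith
  | succ m ih =>
    intro j hj hjk
    push_cast at hj
    have h := hL.sub_order (-((m : ℤ) * k + j))
    rw [ih j (by linarith) hjk,
      show -((m : ℤ) * k + j) + 1 = -((m : ℤ) * k + (j - 1)) by ring,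
      ih (j - 1) (by linarith) (by linarith)] at h
    rw [show -(((m + 1 : ℕ) : ℤ) * k + j) = -((m : ℤ) * k + j) - k by push_cast; ring, h]
    norm_num

theorem apply_one_sub_order (hL : IsGenLucas k L) (hk : 2 ≤ k) : L (1 - k) = -1 := by
  obtain ⟨l, rfl⟩ := Nat.exists_eq_add_of_le' hk
  have h := hL.eq_sum_range 0
  rw [Finset.sum_range_succ, Finset.sum_range_succ', Finset.sum_eq_zero] at h
  · have h₀ := hL.2.1
    have h₁ := hL.2.2.1
    rw [show (1 : ℤ) - ((l + 2 : ℕ) : ℤ) = 0 - ((l + 1 : ℕ) : ℤ) by push_cast; ring]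
    simp only [zero_add, Nat.cast_zero, sub_zero] at h
    linarith
  · intro i hi
    rw [Finset.mem_range] at hi
    apply hL.2.2.2 <;> push_cast <;> omega

end IsGenLucas

theorem value_at_mk_sub_one (k : ℕ) (hk : 3 ≤ k) (L : ℤ → ℤ) (hL : IsGenLucas k L)
    (m : ℕ) (hm : 1 ≤ m) (hmk : (m : ℤ) ≤ (k : ℤ) - 2) :
    L (-((m : ℤ) * k - 1)) = -2 ^ (m - 1) := by
  induction m, hm using Nat.le_induction with
  | base =>
    rw [show -(((1 : ℕ) : ℤ) * k - 1) = 1 - k by push_cast; ring,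
      hL.apply_one_sub_order (by omega)]
    norm_num
  | succ m hm ih =>
    obtain ⟨l, rfl⟩ := Nat.exists_eq_add_of_le' hm
    push_cast at hmk
    have hz := hL.eq_zero l ((k : ℤ) - 2) (by linarith) le_rfl
    have h := hL.sub_order (-(((l + 1 : ℕ) : ℤ) * k - 1))
    rw [ih (by push_cast; linarith),
      show -(((l + 1 : ℕ) : ℤ) * k - 1) + 1 = -((l : ℤ) * k + (k - 2)) by push_cast; ring,
      hz] at h
    rw [show -(((l + 1 + 1 : ℕ) : ℤ) * k - 1) = -(((l + 1 : ℕ) : ℤ) * k - 1) - k by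
      push_cast; ring, h]
    simp only [Nat.add_sub_cancel]
    ring
end

section
/- Let k ≥ 3, let b ≥ 1 be an integer, and let j, r be integers with 0 ≤ j ≤ k-2 and 0 ≤ r ≤ k-2. Then, as rational numbers, L_{-(bk²-bk-1+(j-1)k+r)}^{(k)} = Σ_{i=0}^{b} (-1)^(ik+r+1) · ( ψ(bk+j-b-i-2, ik+r-2)·2^((b-i)k+j-r-b-i) + ψ(bk+j-b-i-2, ik+r-1)·2^((b-i)k+j-r-b-i-2) ). -/
/-- Extended binomial coefficient: `C a b = a.choose b` when `0 ≤ b ≤ a`, and `0` otherwise. -/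
def C (a b : ℤ) : ℤ := if 0 ≤ b ∧ b ≤ a then (a.toNat).choose b.toNat else 0

/-- `ψ(y, z) = C(y, z) + C(y+1, z+1)`. -/
def psi (y z : ℤ) : ℤ := C y z + C (y + 1) (z + 1)

theorem C_eq_zero {a b : ℤ} (h : b < 0 ∨ a < b) : C a b = 0 := by
  unfold C
  rw [if_neg (by omega)]

theorem C_succ {a : ℤ} (ha : 0 ≤ a) (b : ℤ) : C (a + 1) b = C a b + C a (b - 1) := by
  lift a to ℕ using ha
  rcases lt_trichotomy b 0 with hb | rfl | hb
  · rw [C_eq_zero (by omega), C_eq_zero (by omega), C_eq_zero (by omega), add_zero]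
  · rw [C_eq_zero (b := 0 - 1) (by omega)]
    simp [C]
    omega
  · obtain ⟨c, rfl⟩ : ∃ c : ℕ, b = c + 1 := ⟨(b - 1).toNat, by omega⟩
    have C_natCast (m n : ℕ) : C m n = m.choose n := by
      unfold C
      split_ifs with h
      · simp
      · rw [Nat.choose_eq_zero_of_lt (by omega), Nat.cast_zero]
    have h := Nat.choose_succ_succ' a c
    have h₁ := C_natCast (a + 1) (c + 1)
    have h₂ := C_natCast a (c + 1)
    push_cast at h₁ h₂
    rw [add_sub_cancel_right, h₁, h₂, C_natCast, h]
    push_cast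
    ring

theorem psi_succ {y : ℤ} (hy : 0 ≤ y) (z : ℤ) : psi (y + 1) z = psi y z + psi y (z - 1) := by
  unfold psi
  rw [C_succ hy, C_succ (by omega : 0 ≤ y + 1), add_sub_cancel_right, sub_add_cancel]
  ring

theorem psi_eq_zero {y z : ℤ} (h : z < -1 ∨ y < z) : psi y z = 0 := by
  unfold psi
  rw [C_eq_zero (by omega), C_eq_zero (by omega), add_zero]

/-- The summand of the formula for generalized Lucas numbers of negative index: up to a shift,
the contribution of the `n`-th power in the expansion of `1 / (1 - x ^ k * (2 - x))`
to the coefficient of `x ^ (k * n + s)`. -/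
def lucasTerm (n s : ℤ) : ℚ :=
  (-1 : ℚ) ^ (s + 1) *
    ((psi (n - 1) (s - 2) : ℚ) * (2 : ℚ) ^ (n - s + 1) +
      (psi (n - 1) (s - 1) : ℚ) * (2 : ℚ) ^ (n - s - 1))

theorem lucasTerm_eq_zero {n s : ℤ} (h : s < 0 ∨ n + 1 < s) : lucasTerm n s = 0 := by
  unfold lucasTerm
  rw [psi_eq_zero (by omega), psi_eq_zero (by omega)]
  simp

theorem lucasTerm_succ {n : ℤ} (hn : 1 ≤ n) (s : ℤ) :
    lucasTerm (n + 1) s = 2 * lucasTerm n s - lucasTerm n (s - 1) := by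
  have h₁ := psi_succ (y := n - 1) (by omega) (s - 2)
  have h₂ := psi_succ (y := n - 1) (by omega) (s - 1)
  unfold lucasTerm
  rw [show n + 1 - 1 = n - 1 + 1 by ring, h₁, h₂,
    show s - 1 - 2 = s - 2 - 1 by ring,
    show n + 1 - s + 1 = (n - s - 1) + 3 by ring,
    show n + 1 - s - 1 = (n - s - 1) + 1 by ring,
    show n - s + 1 = (n - s - 1) + 2 by ring,
    show n - (s - 1) + 1 = (n - s - 1) + 3 by ring,
    show n - (s - 1) - 1 = (n - s - 1) + 1 by ring,
    show s - 1 + 1 = s by ring]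
  simp only [zpow_add₀ (two_ne_zero : (2 : ℚ) ≠ 0), zpow_add₀ (by norm_num : (-1 : ℚ) ≠ 0)]
  push_cast
  norm_num
  ring

theorem lucasTerm_one_zero : lucasTerm 1 0 = -1 := by
  norm_num [lucasTerm, psi, C]

theorem lucasTerm_one_one : lucasTerm 1 1 = 3 := by
  norm_num [lucasTerm, psi, C]

theorem lucasTerm_one_two : lucasTerm 1 2 = -2 := by
  norm_num [lucasTerm, psi, C]

theorem IsGenLucas.apply_add_one {k : ℕ} {L : ℤ → ℤ} (hL : IsGenLucas k L) (n : ℤ) :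
    L (n + 1) = 2 * L n - L (n - k) := by
  have h (n : ℤ) : L n = ∑ i ∈ Finset.range k, L (n - 1 - i) := by
    rw [hL.1 n, ← Finset.Ico_add_one_right_eq_Icc, Finset.sum_Ico_eq_sum_range]
    refine Finset.sum_congr (by simp) fun i _ => ?_
    congr 1
    push_cast
    ring
  have h₁ := Finset.sum_range_succ (fun i : ℕ => L (n - i)) k
  rw [Finset.sum_range_succ'] at h₁
  have h₂ : ∑ i ∈ Finset.range k, L (n - (i + 1 : ℕ)) = L n := by
    rw [h n]
    refine Finset.sum_congr rfl fun i _ => ?_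
    congr 1
    push_cast
    ring
  have h₃ : ∑ i ∈ Finset.range k, L (n - i) = L (n + 1) := by
    rw [h (n + 1), add_sub_cancel_right]
  rw [h₂, h₃] at h₁
  simp only [Nat.cast_zero, sub_zero] at h₁
  linarith

theorem IsGenLucas.recurrence {k : ℕ} {L : ℤ → ℤ} (hL : IsGenLucas k L) (N : ℤ) :
    L (1 - N) = 2 * L (1 - (N - k)) - L (1 - (N - k - 1)) := by
  have h := hL.apply_add_one (1 - (N - k))
  rw [show 1 - (N - k) - k = 1 - N by ring, show 1 - (N - k) + 1 = 1 - (N - k - 1) by ring] at h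
  linarith

theorem IsGenLucas.apply_one_sub_order_s12 {k : ℕ} (hk : 2 ≤ k) {L : ℤ → ℤ} (hL : IsGenLucas k L) :
    L (1 - k) = -1 := by
  obtain ⟨hr, h0, h1, hz⟩ := hL
  have h := hr 1
  obtain ⟨m, rfl⟩ : ∃ m, k = m + 2 := ⟨k - 2, by omega⟩
  rw [h1, Finset.sum_Icc_succ_top (by omega), ← Finset.add_sum_Ioc_eq_sum_Icc (by omega),
    Finset.sum_eq_zero] at h
  · rw [add_zero, Nat.cast_one, sub_self, h0] at h
    linarith
  · intro i hi
    rw [Finset.mem_Ioc] at hi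
    exact hz _ (by push_cast; omega) (by omega)

theorem IsGenLucas.apply_one_sub {k : ℕ} (hk : 3 ≤ k) {L : ℤ → ℤ} (hL : IsGenLucas k L)
    (N : ℕ) (hN : 2 ≤ N) (K : ℕ) (hK : N < k * (K + 1)) :
    (L (1 - N) : ℚ) = ∑ n ∈ Finset.range K, lucasTerm (n + 1) (N - k * (n + 1)) := by
  induction N using Nat.strong_induction_on generalizing K with
  | _ N ih =>
    obtain ⟨-, h0, h1, hz⟩ := id hL
    have hzero (M : ℤ) (h₂ : 2 ≤ M) (h₃ : M ≤ k - 1) : L (1 - M) = 0 :=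
      hz _ (by omega) (by omega)
    rcases lt_or_ge N k with hNk | hNk
    · rw [hzero N (by omega) (by omega), Finset.sum_eq_zero, Int.cast_zero]
      intro n _
      refine lucasTerm_eq_zero (Or.inl ?_)
      nlinarith
    obtain ⟨K, rfl⟩ : ∃ K', K = K' + 1 := by
      refine ⟨K - 1, ?_⟩
      rcases K with - | K
      · simp at hK; omega
      · rfl
    have hK' : N < k * (K + 1) + k := by linarith
    obtain ⟨M, rfl⟩ : ∃ M, N = M + k := ⟨N - k, by omega⟩
    have hM : M < k * (K + 1) := by omega
    have hrec := hL.recurrence (M + k : ℕ)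
    push_cast at hrec ⊢
    rw [add_sub_cancel_right] at hrec
    rw [Finset.sum_range_succ']
    have hstep (n : ℕ) : lucasTerm ((n + 1 : ℕ) + 1) (M + k - k * ((n + 1 : ℕ) + 1)) =
        2 * lucasTerm (n + 1) (M - k * (n + 1)) - lucasTerm (n + 1) (M - 1 - k * (n + 1)) := by
      push_cast
      rw [lucasTerm_succ (by omega)]
      rw [show (M + k - k * (n + 1 + 1) : ℤ) = M - k * (n + 1) by ring,
        show (M - k * (n + 1) - 1 : ℤ) = M - 1 - k * (n + 1) by ring]
    simp only [hstep, Finset.sum_sub_distrib, ← Finset.mul_sum]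
    have hsmall (s : ℤ) (hs : s < k) :
        ∑ n ∈ Finset.range K, lucasTerm (n + 1) (s - k * (n + 1)) = 0 := by
      refine Finset.sum_eq_zero fun n _ => lucasTerm_eq_zero (Or.inl ?_)
      nlinarith
    simp only [Nat.cast_zero, zero_add, mul_one, add_sub_cancel_right]
    obtain rfl | rfl | rfl | hM3 : M = 0 ∨ M = 1 ∨ M = 2 ∨ 3 ≤ M := by omega
    · rw [hsmall _ (by push_cast; omega), hsmall _ (by push_cast; omega)]
      norm_num [hL.apply_one_sub_order_s12 (by omega), lucasTerm_one_zero]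
    · rw [hsmall _ (by push_cast; omega), hsmall _ (by push_cast; omega), hrec]
      norm_num [h0, h1, lucasTerm_one_one]
    · rw [hrec, hsmall _ (by push_cast; omega), hsmall _ (by push_cast; omega)]
      have := hzero 2 le_rfl (by omega)
      norm_num at this
      norm_num [h0, h1, this, lucasTerm_one_two]
    · have e₁ := ih M (by omega) (by omega) K hM
      have e₂ := ih (M - 1) (by omega) (by omega) K (by omega)
      rw [Nat.cast_sub (by omega), Nat.cast_one] at e₂
      rw [hrec]
      push_cast
      rw [e₁, e₂, lucasTerm_eq_zero (n := 1) (by omega), add_zero]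

theorem sum_range_lucasTerm_eq_sum_Icc {k : ℕ} (hk : 3 ≤ k) {b j r : ℤ} (hb : 1 ≤ b)
    (hj1 : 0 ≤ j) (hj2 : j ≤ k - 2) (hr : 0 ≤ r) (q : ℕ) (hq : (q : ℤ) = b * k - b + j - 1) :
    ∑ n ∈ Finset.range q, lucasTerm (n + 1) (k * q + r - k * (n + 1)) =
      ∑ i ∈ Finset.Icc (0 : ℤ) b, lucasTerm (q - i) (i * k + r) := by
  lift b to ℕ using by omega
  have hIcc : ∑ i ∈ Finset.Icc (0 : ℤ) b, lucasTerm (q - i) (i * k + r) =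
      ∑ i ∈ Finset.range (b + 1), lucasTerm (q - i) (i * k + r) := by
    symm
    refine Finset.sum_bij (fun i _ => (i : ℤ)) ?_ ?_ ?_ ?_
    · intro i hi
      simp at hi ⊢
      omega
    · intro i _ i' _ h
      exact_mod_cast h
    · intro i hi
      rw [Finset.mem_Icc] at hi
      exact ⟨i.toNat, by simp; omega, by omega⟩
    · intro i _
      rfl
  rw [hIcc, ← Finset.sum_range_reflect]
  have hrefl : ∑ n ∈ Finset.range q,
      lucasTerm ((q - 1 - n : ℕ) + 1) (k * q + r - k * ((q - 1 - n : ℕ) + 1)) =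
      ∑ i ∈ Finset.range q, lucasTerm (q - i) (i * k + r) := by
    refine Finset.sum_congr rfl fun n hn => ?_
    rw [Finset.mem_range] at hn
    rw [show ((q - 1 - n : ℕ) : ℤ) = q - 1 - n by omega]
    congr 1 <;> ring
  rw [hrefl]
  have hsub (m : ℕ) (hle : m ≤ max q (b + 1))
      (hm : ∀ i : ℕ, m ≤ i → lucasTerm (q - i) (i * k + r) = 0) :
      ∑ i ∈ Finset.range m, lucasTerm (q - i) (i * k + r) =
        ∑ i ∈ Finset.range (max q (b + 1)), lucasTerm (q - i) (i * k + r) := by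
    refine Finset.sum_subset (Finset.range_mono hle) fun i _ hi => hm i ?_
    simpa using hi
  rw [hsub q (le_max_left _ _), hsub (b + 1) (le_max_right _ _)]
  · intro i hi
    refine lucasTerm_eq_zero (Or.inr ?_)
    zify at hi hk
    nlinarith
  · intro i hi
    refine lucasTerm_eq_zero (Or.inr ?_)
    zify at hi hk
    nlinarith

theorem value_general_block (k : ℕ) (hk : 3 ≤ k) (L : ℤ → ℤ) (hL : IsGenLucas k L)
    (b : ℤ) (hb : 1 ≤ b)
    (j r : ℤ) (hj1 : 0 ≤ j) (hj2 : j ≤ (k : ℤ) - 2) (hr1 : 0 ≤ r) (hr2 : r ≤ (k : ℤ) - 2) :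
    (L (-(b * (k : ℤ) ^ 2 - b * k - 1 + (j - 1) * k + r)) : ℚ) =
      ∑ i ∈ Finset.Icc (0 : ℤ) b,
        (-1 : ℚ) ^ (i * k + r + 1) *
          ((psi (b * k + j - b - i - 2) (i * k + r - 2) : ℚ) *
              (2 : ℚ) ^ ((b - i) * k + j - r - b - i) +
            (psi (b * k + j - b - i - 2) (i * k + r - 1) : ℚ) *
              (2 : ℚ) ^ ((b - i) * k + j - r - b - i - 2)) := by
  have hk' : (3 : ℤ) ≤ k := by exact_mod_cast hk
  obtain ⟨q, hq⟩ : ∃ q : ℕ, (q : ℤ) = b * k - b + j - 1 :=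
    ⟨(b * k - b + j - 1).toNat, Int.toNat_of_nonneg (by nlinarith)⟩
  lift r to ℕ using hr1
  have hq1 : 1 ≤ q := by
    zify
    nlinarith
  have hmain := hL.apply_one_sub hk (k * q + r) (by nlinarith) q (by zify; nlinarith)
  push_cast at hmain
  rw [sum_range_lucasTerm_eq_sum_Icc hk hb hj1 hj2 (by omega) q hq] at hmain
  rw [show -(b * (k : ℤ) ^ 2 - b * k - 1 + (j - 1) * k + r) = 1 - (k * q + r) by rw [hq]; ring,
    hmain]
  refine Finset.sum_congr rfl fun i _ => ?_
  unfold lucasTerm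
  rw [hq]
  rw [show b * k - b + j - 1 - i - 1 = b * k + j - b - i - 2 by ring,
    show b * k - b + j - 1 - i - (i * k + r) + 1 = (b - i) * k + j - r - b - i by ring,
    show b * k - b + j - 1 - i - (i * k + r) - 1 = (b - i) * k + j - r - b - i - 2 by ring]
end

section
/- Let k be an even integer with 4 ≤ k ≤ 500 and let n ≥ 0 be an integer such that L_{-n}^{(k)} = 0. Then n ≤ 9293983. -/
namespace IsGenLucas

variable {k : ℕ} {L : ℤ → ℤ}

theorem sub_succ_eq (hL : IsGenLucas k L) (n : ℤ) :
    L (n - (k + 1)) = 2 * L (n - 1) - L n := by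
  have key : ∀ m : ℕ, ∑ i ∈ Finset.Icc 1 m, L (n - 1 - (i : ℤ)) + L (n - 1) =
      ∑ i ∈ Finset.Icc 1 m, L (n - (i : ℤ)) + L (n - (m + 1)) := by
    intro m
    induction m with
    | zero => simp
    | succ m ih =>
      rw [Finset.sum_Icc_succ_top (by omega), Finset.sum_Icc_succ_top (by omega)]
      have h : n - 1 - ((m + 1 : ℕ) : ℤ) = n - (((m + 1 : ℕ) : ℤ) + 1) := by ring
      rw [h]
      push_cast at ih ⊢
      linarith
  have h := key k
  rw [← hL.1 n, ← hL.1 (n - 1)] at h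
  linarith

theorem neg_self (hL : IsGenLucas k L) : L (-(k : ℤ)) = 3 := by
  have h := hL.sub_succ_eq 1
  rw [show (1 : ℤ) - (k + 1) = -(k : ℤ) by ring, sub_self, hL.2.1, hL.2.2.1] at h
  linarith

theorem one_sub (hL : IsGenLucas k L) (hk : 2 ≤ k) : L (1 - (k : ℤ)) = -1 := by
  obtain ⟨m, rfl⟩ := Nat.exists_eq_add_of_le' hk
  have h := hL.1 1
  rw [Finset.sum_Icc_succ_top (by omega), Finset.sum_eq_single 1, hL.2.2.1] at h
  · simp only [Nat.cast_one, sub_self, hL.2.1] at h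
    push_cast at h ⊢
    rw [show (m : ℤ) + 2 = m + 1 + 1 by ring]
    linarith
  · intro i hi hi1
    rw [Finset.mem_Icc] at hi
    apply hL.2.2.2 <;> push_cast <;> omega
  · simp

/-- For even `k` the sign-adjusted sequence `(-1) ^ n * L (-n)` satisfies a recurrence with
nonnegative coefficients. -/
theorem signed_recurrence (hL : IsGenLucas k L) (hk : Even k) (n : ℕ) :
    (-1) ^ (n + k + 1) * L (-((n + k + 1 : ℕ) : ℤ)) =
      2 * ((-1) ^ (n + 1) * L (-((n + 1 : ℕ) : ℤ))) + (-1) ^ n * L (-(n : ℤ)) := by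
  have h := hL.sub_succ_eq (-(n : ℤ))
  rw [show -((n + k + 1 : ℕ) : ℤ) = -(n : ℤ) - (k + 1) by push_cast; ring,
    show -((n + 1 : ℕ) : ℤ) = -(n : ℤ) - 1 by push_cast; ring, h, pow_succ, pow_add,
    hk.neg_one_pow, pow_succ]
  ring

theorem signed_nonneg (hL : IsGenLucas k L) (hk2 : 2 ≤ k) (hk : Even k) (n : ℕ) :
    0 ≤ (-1) ^ n * L (-(n : ℤ)) := by
  induction n using Nat.strong_induction_on with
  | _ n ih =>
    rcases lt_or_ge k n with hn | hn
    · obtain ⟨m, rfl⟩ := Nat.exists_eq_add_of_le' hn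
      have h := hL.signed_recurrence hk m
      have h₀ := ih m (by omega)
      have h₁ := ih (m + 1) (by omega)
      rw [Nat.succ_eq_add_one, ← add_assoc, h]
      linarith
    rcases hn.eq_or_lt with rfl | hn
    · rw [hk.neg_one_pow, hL.neg_self]
      norm_num
    rcases n.eq_zero_or_pos with rfl | hn₀
    · simp [hL.2.1]
    by_cases hn' : n + 1 = k
    · have hodd : Odd n := by
        rw [← hn', Nat.even_add_one, Nat.not_even_iff_odd] at hk
        exact hk
      rw [hodd.neg_one_pow, show -(n : ℤ) = 1 - (k : ℤ) by omega, hL.one_sub hk2]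
      norm_num
    · rw [hL.2.2.2 _ (by omega) (by omega), mul_zero]

theorem signed_pos (hL : IsGenLucas k L) (hk2 : 2 ≤ k) (hk : Even k) (q : ℕ) :
    ∀ r ≤ q, 0 < (-1) ^ (k * q + r) * L (-((k * q + r : ℕ) : ℤ)) := by
  induction q with
  | zero =>
    intro r hr
    obtain rfl : r = 0 := by omega
    simp [hL.2.1]
  | succ q ih =>
    rintro (_ | r) hr
    · rcases q.eq_zero_or_pos with rfl | hq
      · simp [hk.neg_one_pow, hL.neg_self]
      · obtain ⟨m, hm⟩ : ∃ m, k * q = m + 1 :=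
          Nat.exists_eq_succ_of_ne_zero (Nat.mul_ne_zero (by omega) (by omega))
        have h := hL.signed_recurrence hk m
        have h₀ := hL.signed_nonneg hk2 hk m
        have h₁ := ih 0 (Nat.zero_le q)
        rw [add_zero, hm] at h₁
        rw [show k * (q + 1) + 0 = m + k + 1 by rw [mul_add, hm]; ring, h]
        linarith
    · have h := hL.signed_recurrence hk (k * q + r)
      have h₀ := ih r (by omega)
      have h₁ := hL.signed_nonneg hk2 hk (k * q + r + 1)
      rw [show k * (q + 1) + (r + 1) = k * q + r + k + 1 by ring, h]
      linarith

theorem lt_sq_of_neg_eq_zero (hL : IsGenLucas k L) (hk2 : 2 ≤ k) (hk : Even k) {n : ℕ}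
    (hn : L (-(n : ℤ)) = 0) : n < k ^ 2 := by
  by_contra! hle
  have hq : k ≤ n / k := (Nat.le_div_iff_mul_le (by omega)).2 (by rwa [← sq])
  have hr : n % k < k := Nat.mod_lt _ (by omega)
  have h := hL.signed_pos hk2 hk (n / k) (n % k) (by omega)
  rw [Nat.div_add_mod, hn, mul_zero] at h
  exact lt_irrefl _ h

end IsGenLucas

theorem zero_bound_even_small_k (k : ℕ) (hk1 : 4 ≤ k) (hk2 : k ≤ 500) (hke : Even k)
    (L : ℤ → ℤ) (hL : IsGenLucas k L) (n : ℕ) (hn : L (-(n : ℤ)) = 0) :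
    n ≤ 9293983 := by
  have h := hL.lt_sq_of_neg_eq_zero (by omega) hke hn
  nlinarith
end
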